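/- arXiv:2103.14309 — 2 statements merged into one kernel-verified Lean document; each statement's English description precedes it below -/
import Mathlib

section
/- For a generic map f in C_λ(I) (i.e., for every f in some residual subset of C_λ(I)) and for every integer k ≥ 1, the lower box dimension of the set Fix(f,k) = {x ∈ [0,1] : f^k(x) = x} is zero, i.e., liminf_{ε→0⁺} log N(Fix(f,k),ε)/log(1/ε) = 0. -/
open MeasureTheory Set Metric Filter Topology

noncomputable section

/-- Lebesgue measure on the unit interval `[0,1]`, viewed as a measure on the subtype. -/
def lebI : Measure unitInterval := (volume : Measure ℝ).comap Subtype.val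

/-- A continuous self-map of `[0,1]` preserves Lebesgue measure. -/
def MeasPres (f : C(unitInterval, unitInterval)) : Prop :=
  ∀ A : Set unitInterval, MeasurableSet A → lebI (f ⁻¹' A) = lebI A

/-- The space `C_λ(I)` of continuous Lebesgue-measure-preserving maps of `[0,1]`. -/
def CLam : Set C(unitInterval, unitInterval) := {f | MeasPres f}

/-- `Fix(f,k) = {x : f^k x = x}`. -/
def FixSet {X : Type*} (f : X → X) (k : ℕ) : Set X := {x | f^[k] x = x}

/-- `Per(f,k) = {x : f^k x = x and f^i x ≠ x for 1 ≤ i < k}`. -/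
def PerSet {X : Type*} (f : X → X) (k : ℕ) : Set X :=
  {x | f^[k] x = x ∧ ∀ i : ℕ, 1 ≤ i → i < k → f^[i] x ≠ x}

/-- `Per(f) = ⋃_{k ≥ 1} Fix(f,k)`, the set of all periodic points. -/
def PerAll {X : Type*} (f : X → X) : Set X := ⋃ k ∈ {k : ℕ | 1 ≤ k}, FixSet f k

/-- A Cantor set: nonempty, compact, perfect and totally disconnected. -/
def IsCantorSet {X : Type*} [TopologicalSpace X] (C : Set X) : Prop :=
  C.Nonempty ∧ IsCompact C ∧ Perfect C ∧ IsTotallyDisconnected C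

/-- `N(A,ε)`: the smallest number of sets of diameter at most `ε` needed to cover `A`. -/
def coverNum {X : Type*} [MetricSpace X] (A : Set X) (ε : ℝ) : ℕ :=
  sInf {n : ℕ | ∃ U : Fin n → Set X, (∀ i, Metric.diam (U i) ≤ ε) ∧ A ⊆ ⋃ i, U i}

/-- The lower box dimension: `liminf_{ε→0⁺} log N(A,ε) / log(1/ε)`. -/
def lowerBoxDim {X : Type*} [MetricSpace X] (A : Set X) : ℝ :=
  Filter.liminf (fun ε : ℝ => Real.log (coverNum A ε) / Real.log (1 / ε)) (𝓝[>] (0 : ℝ))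

/-- The upper box dimension: `limsup_{ε→0⁺} log N(A,ε) / log(1/ε)`. -/
def upperBoxDim {X : Type*} [MetricSpace X] (A : Set X) : ℝ :=
  Filter.limsup (fun ε : ℝ => Real.log (coverNum A ε) / Real.log (1 / ε)) (𝓝[>] (0 : ℝ))

open scoped unitInterval

lemma lebI_eq_volume : lebI = (volume : Measure I) := rfl

/-- Itineraries separate periodic points of a map expanding on finitely many pieces. -/
lemma finite_fixSet_of_expanding {X ι : Type*} [MetricSpace X] [Finite ι] {g : X → X} (c : X → ι)
    (hg : ∀ x y, x ≠ y → c x = c y → dist x y < dist (g x) (g y)) {k : ℕ} (hk : 1 ≤ k) :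
    (FixSet g k).Finite := by
  have hinj : InjOn (fun (x : X) (i : Fin k) => c (g^[i] x)) (FixSet g k) := by
    intro x hx y hy hxy
    by_contra hne
    have key : ∀ i, i < k → dist x y < dist (g^[i + 1] x) (g^[i + 1] y) := by
      intro i
      induction i with
      | zero => intro h; exact hg x y hne (congrFun hxy ⟨0, h⟩)
      | succ i ih =>
        intro h
        have h1 := ih (by omega)
        rw [Function.iterate_succ_apply' g (i + 1), Function.iterate_succ_apply' g (i + 1)]
        refine h1.trans (hg _ _ ?_ (congrFun hxy ⟨i + 1, h⟩))
        exact dist_pos.1 (dist_nonneg.trans_lt h1)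
    have := key (k - 1) (by omega)
    rw [Nat.sub_add_cancel hk, hx, hy] at this
    exact lt_irrefl _ this
  exact Finite.of_injOn (mapsTo_univ _ _) hinj finite_univ

/-- The distribution function of `p`, evaluated along `p`. -/
def distributionTransform (p : C(I, ℝ)) (x : I) : ℝ := volume.real {z : I | p z ≤ p x}

section DistributionTransform

variable {p : C(I, ℝ)}

lemma distributionTransform_mem (x : I) : distributionTransform p x ∈ I :=
  ⟨measureReal_nonneg, measureReal_le_one⟩

lemma distributionTransform_mono {x y : I} (h : p x ≤ p y) :
    distributionTransform p x ≤ distributionTransform p y :=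
  measureReal_mono (fun _ hz => le_trans hz h)

lemma continuous_distributionTransform (hp : ∀ y, volume {z : I | p z = y} = 0) :
    Continuous (distributionTransform p) := by
  have hm : Measurable p := p.continuous.measurable
  set ν : Measure ℝ := Measure.map p volume with hν
  have : IsProbabilityMeasure ν := Measure.isProbabilityMeasure_map hm.aemeasurable
  have hcont : Continuous (ProbabilityTheory.cdf ν) := by
    rw [continuous_iff_continuousAt]
    intro a
    rw [(ProbabilityTheory.monotone_cdf ν).continuousAt_iff_leftLim_eq_rightLim,
      StieltjesFunction.rightLim_eq]
    have h0 : ν {a} = 0 := by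
      rw [hν, Measure.map_apply hm (measurableSet_singleton a)]
      exact hp a
    rw [← ProbabilityTheory.measure_cdf ν, StieltjesFunction.measure_singleton,
      ENNReal.ofReal_eq_zero] at h0
    exact le_antisymm ((ProbabilityTheory.monotone_cdf ν).leftLim_le le_rfl) (by linarith)
  have : distributionTransform p = fun x => ProbabilityTheory.cdf ν (p x) := by
    ext x
    rw [ProbabilityTheory.cdf_eq_real, hν, map_measureReal_apply hm measurableSet_Iic]
    rfl
  rw [this]
  exact hcont.comp p.continuous

lemma distributionTransform_surj (hp : ∀ y, volume {z : I | p z = y} = 0) {t : ℝ} (ht : t ∈ I) :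
    ∃ x, distributionTransform p x = t := by
  obtain ⟨a, -, ha⟩ := isCompact_univ.exists_isMinOn univ_nonempty p.continuous.continuousOn
  obtain ⟨b, -, hb⟩ := isCompact_univ.exists_isMaxOn univ_nonempty p.continuous.continuousOn
  have h0 : distributionTransform p a = 0 := by
    have : {z : I | p z ≤ p a} = {z | p z = p a} := by
      ext z
      exact ⟨fun h => le_antisymm h (ha (mem_univ z)), fun h => le_of_eq h⟩
    rw [distributionTransform, this, measureReal_def, hp, ENNReal.toReal_zero]
  have h1 : distributionTransform p b = 1 := by
    have : {z : I | p z ≤ p b} = univ := eq_univ_of_forall fun z => hb (mem_univ z)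
    rw [distributionTransform, this, probReal_univ]
  have := intermediate_value_univ a b (continuous_distributionTransform hp)
  rw [h0, h1] at this
  exact this ht

lemma volume_distributionTransform_le (hp : ∀ y, volume {z : I | p z = y} = 0) {t : ℝ}
    (ht : t ∈ I) : volume.real {z : I | distributionTransform p z ≤ t} = t := by
  apply le_antisymm
  · apply le_of_forall_gt_imp_ge_of_dense
    intro s hs
    rcases le_or_gt 1 s with h1 | h1
    · exact measureReal_le_one.trans h1
    · obtain ⟨y, hy⟩ := distributionTransform_surj hp (t := s) ⟨ht.1.trans hs.le, h1.le⟩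
      rw [← hy]
      refine measureReal_mono fun z hz => ?_
      by_contra hlt
      have := distributionTransform_mono (p := p) (x := y) (y := z) (not_le.1 hlt).le
      have hz' : distributionTransform p z ≤ t := hz
      linarith
  · obtain ⟨x, hx⟩ := distributionTransform_surj hp ht
    rw [← hx]
    exact measureReal_mono fun z hz => distributionTransform_mono hz

lemma exists_measPres_eq_distributionTransform (hp : ∀ y, volume {z : I | p z = y} = 0) :
    ∃ g : C(I, I), MeasPres g ∧ ∀ x, (g x : ℝ) = distributionTransform p x := by
  let g : C(I, I) := ⟨fun x => ⟨distributionTransform p x, distributionTransform_mem x⟩,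
    (continuous_distributionTransform hp).subtype_mk _⟩
  refine ⟨g, ?_, fun x => rfl⟩
  have hg : Measurable g := g.continuous.measurable
  have : Measure.map g (volume : Measure I) = volume := by
    have : IsProbabilityMeasure (Measure.map g (volume : Measure I)) :=
      Measure.isProbabilityMeasure_map hg.aemeasurable
    refine Measure.ext_of_Iic _ _ fun t => ?_
    rw [Measure.map_apply hg measurableSet_Iic, unitInterval.volume_Iic,
      ← volume_distributionTransform_le hp t.2, ofReal_measureReal]
    rfl
  intro A hA
  rw [lebI_eq_volume, ← Measure.map_apply hg hA, this]

lemma volume_preimage_uIcc_le (hp : ∀ y, volume {z : I | p z = y} = 0) (x y : I) :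
    volume.real (p ⁻¹' uIcc (p x) (p y)) ≤
      |distributionTransform p x - distributionTransform p y| := by
  wlog h : p x ≤ p y generalizing x y
  · rw [uIcc_comm, abs_sub_comm]
    exact this y x (not_le.1 h).le
  have hsub : p ⁻¹' uIcc (p x) (p y) ⊆
      ({z | p z ≤ p y} \ {z | p z ≤ p x}) ∪ {z | p z = p x} := by
    intro z hz
    rw [uIcc_of_le h] at hz
    rcases hz.1.eq_or_lt with h1 | h1
    · exact Or.inr h1.symm
    · exact Or.inl ⟨hz.2, not_le.2 h1⟩
  have hm : MeasurableSet {z | p z ≤ p x} := measurableSet_le p.continuous.measurable (by fun_prop)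
  calc volume.real (p ⁻¹' uIcc (p x) (p y))
      ≤ volume.real ({z | p z ≤ p y} \ {z | p z ≤ p x}) + volume.real {z | p z = p x} :=
        (measureReal_mono hsub).trans (measureReal_union_le _ _)
    _ = distributionTransform p y - distributionTransform p x := by
        rw [measureReal_def _ {z | p z = p x}, hp, ENNReal.toReal_zero, add_zero,
          measureReal_sdiff (show {z | p z ≤ p x} ⊆ {z | p z ≤ p y} from
            fun z hz => le_trans hz h) hm]
        rfl
    _ ≤ _ := by rw [abs_sub_comm]; exact le_abs_self _

lemma abs_distributionTransform_sub_le {f : C(I, I)} (hf : MeasPres f) {δ : ℝ}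
    (hδ : ∀ x, |p x - f x| ≤ δ) (x : I) : |distributionTransform p x - f x| ≤ 2 * δ := by
  have hδ0 : 0 ≤ δ := (abs_nonneg _).trans (hδ x)
  have hvol : ∀ t : I, volume.real {z : I | f z ≤ t} = t := fun t => by
    have := hf (Iic t) measurableSet_Iic
    rw [lebI_eq_volume, unitInterval.volume_Iic] at this
    rw [measureReal_def]
    change (volume (f ⁻¹' Iic t)).toReal = t
    rw [this, ENNReal.toReal_ofReal t.2.1]
  have hx := abs_le.1 (hδ x)
  rw [abs_le]
  constructor
  · rcases le_or_gt 0 ((f x : ℝ) - 2 * δ) with h | h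
    · have hs : {z : I | f z ≤ (⟨f x - 2 * δ, h, by linarith [(f x).2.2]⟩ : I)} ⊆
          {z | p z ≤ p x} := by
        intro z hz
        have hz' : (f z : ℝ) ≤ f x - 2 * δ := hz
        have := abs_le.1 (hδ z)
        change p z ≤ p x
        linarith
      have := measureReal_mono (μ := volume) hs
      rw [hvol] at this
      change (f x : ℝ) - 2 * δ ≤ distributionTransform p x at this
      linarith
    · linarith [(distributionTransform_mem (p := p) x).1]
  · rcases le_or_gt ((f x : ℝ) + 2 * δ) 1 with h | h
    · have hs : {z | p z ≤ p x} ⊆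
          {z : I | f z ≤ (⟨f x + 2 * δ, by linarith [(f x).2.1], h⟩ : I)} := by
        intro z hz
        have hz' : p z ≤ p x := hz
        have := abs_le.1 (hδ z)
        change (f z : ℝ) ≤ f x + 2 * δ
        linarith
      have := measureReal_mono (μ := volume) hs
      rw [hvol] at this
      change distributionTransform p x ≤ (f x : ℝ) + 2 * δ at this
      linarith
    · linarith [(distributionTransform_mem (p := p) x).2]

end DistributionTransform

lemma continuous_iterate_uncurry {X : Type*} [TopologicalSpace X] [LocallyCompactSpace X] (k : ℕ) :
    Continuous fun q : C(X, X) × X => (q.1 : X → X)^[k] q.2 := by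
  induction k with
  | zero => exact continuous_snd
  | succ k ih =>
    simp only [Function.iterate_succ_apply']
    exact continuous_fst.eval ih

lemma eventually_fixSet_subset {X : Type*} [TopologicalSpace X] [CompactSpace X] [T2Space X]
    (f : C(X, X)) (k : ℕ) {V : Set X} (hV : IsOpen V) (hf : FixSet f k ⊆ V) :
    ∀ᶠ g : C(X, X) in 𝓝 f, FixSet g k ⊆ V := by
  have hC : IsClosed {q : C(X, X) × X | (q.1 : X → X)^[k] q.2 = q.2 ∧ q.2 ∈ Vᶜ} :=
    (isClosed_eq (continuous_iterate_uncurry k) continuous_snd).inter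
      (hV.isClosed_compl.preimage continuous_snd)
  have hO := (isClosedMap_fst_of_compactSpace _ hC).isOpen_compl
  have hfm : f ∈ (Prod.fst '' {q : C(X, X) × X | (q.1 : X → X)^[k] q.2 = q.2 ∧ q.2 ∈ Vᶜ})ᶜ := by
    rintro ⟨⟨g, x⟩, ⟨h1, h2⟩, rfl⟩
    exact h2 (hf h1)
  filter_upwards [hO.mem_nhds hfm] with g hg x hx
  by_contra hxV
  exact hg ⟨(g, x), ⟨hx, hxV⟩, rfl⟩

lemma coverNum_le_card {X : Type*} [MetricSpace X] {A : Set X} (F : Finset X) {ε : ℝ} (hε : 0 ≤ ε)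
    (hA : A ⊆ ⋃ x ∈ F, ball x (ε / 2)) : coverNum A ε ≤ F.card := by
  refine Nat.sInf_le ⟨fun i => ball (F.equivFin.symm i : X) (ε / 2), fun i => ?_, fun x hx => ?_⟩
  · exact (diam_ball (by linarith)).trans (by linarith)
  · obtain ⟨y, hy, hxy⟩ := mem_iUnion₂.1 (hA hx)
    exact mem_iUnion.2 ⟨F.equivFin ⟨y, hy⟩, by simpa using hxy⟩

/-- At some scale `ε < η`, the exponent `log N(A,ε) / log(1/ε)` is at most `η`. -/
def SmallAtScale {X : Type*} [MetricSpace X] (A : Set X) (η : ℝ) : Prop :=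
  ∃ ε : ℝ, 0 < ε ∧ ε < η ∧ ε < 1 ∧ Real.log (coverNum A ε) / Real.log (1 / ε) ≤ η

lemma lowerBoxDim_eq_zero {X : Type*} [MetricSpace X] {A : Set X}
    (h : ∀ η > 0, SmallAtScale A η) : lowerBoxDim A = 0 := by
  set u : ℝ → ℝ := fun ε => Real.log (coverNum A ε) / Real.log (1 / ε) with hu
  have hpos : ∀ᶠ ε in 𝓝[>] (0 : ℝ), 0 ≤ u ε := by
    filter_upwards [Ioo_mem_nhdsGT (zero_lt_one' ℝ)] with ε hε
    exact div_nonneg (Real.log_natCast_nonneg _)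
      (Real.log_nonneg ((one_le_div hε.1).2 hε.2.le))
  have hfreq : ∀ η > 0, ∃ᶠ ε in 𝓝[>] (0 : ℝ), u ε ≤ η := by
    intro η hη
    rw [frequently_iff]
    intro U hU
    obtain ⟨b, hb, hbU⟩ := mem_nhdsGT_iff_exists_Ioo_subset.1 hU
    obtain ⟨ε, h0, h1, -, h2⟩ := h (min η b) (lt_min hη hb)
    exact ⟨ε, hbU ⟨h0, h1.trans_le (min_le_right _ _)⟩, h2.trans (min_le_left _ _)⟩
  apply le_antisymm
  · refine le_of_forall_gt_imp_ge_of_dense fun η hη => ?_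
    exact liminf_le_of_frequently_le (hfreq η hη) ⟨0, hpos⟩
  · exact le_liminf_of_le (IsCoboundedUnder.of_frequently_le (hfreq 1 one_pos)) hpos

lemma eventually_smallAtScale (f : C(I, I)) {k : ℕ} (hfin : (FixSet f k).Finite) {η : ℝ}
    (hη : 0 < η) : ∀ᶠ g : C(I, I) in 𝓝 f, SmallAtScale (FixSet g k) η := by
  set F := hfin.toFinset
  have hlog : Tendsto (fun ε : ℝ => η * Real.log (1 / ε)) (𝓝[>] 0) atTop := by
    refine Tendsto.const_mul_atTop hη (Real.tendsto_log_atTop.comp ?_)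
    exact tendsto_inv_nhdsGT_zero.congr fun x => (one_div x).symm
  have hsmall : ∀ᶠ ε in 𝓝[>] (0 : ℝ), ε ∈ Ioo 0 (min η 1) :=
    Ioo_mem_nhdsGT (lt_min hη zero_lt_one)
  obtain ⟨ε, ⟨h0, h1⟩, h2⟩ :=
    (hsmall.and (hlog.eventually_ge_atTop (Real.log F.card))).exists
  have hε1 : ε < 1 := h1.trans_le (min_le_right _ _)
  have hV : IsOpen (⋃ x ∈ F, ball x (ε / 2)) := isOpen_biUnion fun x _ => isOpen_ball
  have hsub : FixSet f k ⊆ ⋃ x ∈ F, ball x (ε / 2) := fun x hx =>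
    mem_biUnion (hfin.mem_toFinset.2 hx) (mem_ball_self (by linarith))
  filter_upwards [eventually_fixSet_subset f k hV hsub] with g hg
  refine ⟨ε, h0, h1.trans_le (min_le_left _ _), hε1, ?_⟩
  rw [div_le_iff₀ (Real.log_pos ((one_lt_div h0).2 hε1))]
  refine le_trans ?_ h2
  have hle := coverNum_le_card F h0.le hg
  rcases Nat.eq_zero_or_pos (coverNum (FixSet g k) ε) with h | h
  · rw [h]; simpa using Real.log_natCast_nonneg _
  · exact Real.log_le_log (by exact_mod_cast h) (by exact_mod_cast hle)

/-- The continuous piecewise affine function with value `w j` at each node `j ≤ N`, constant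
outside `[0, N]`. -/
def polygonal (w : ℕ → ℝ) (N : ℕ) (t : ℝ) : ℝ :=
  w 0 + ∑ i ∈ Finset.range N, (w (i + 1) - w i) * max 0 (min 1 (t - i))

lemma continuous_polygonal (w : ℕ → ℝ) (N : ℕ) : Continuous (polygonal w N) := by
  unfold polygonal
  fun_prop

lemma polygonal_eq (w : ℕ → ℝ) {N j : ℕ} (hj : j < N) {t : ℝ} (ht : t ∈ Icc (j : ℝ) (j + 1)) :
    polygonal w N t = w j + (w (j + 1) - w j) * (t - j) := by
  have hlow : ∀ n ≤ j, polygonal w n t = w n := by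
    intro n
    induction n with
    | zero => simp [polygonal]
    | succ n ih =>
      intro hn
      have h1 : (n : ℝ) + 1 ≤ j := by exact_mod_cast hn
      have ih' := ih (by omega)
      unfold polygonal at ih' ⊢
      rw [Finset.sum_range_succ, ← add_assoc, ih', min_eq_left (by linarith [ht.1]),
        max_eq_right zero_le_one]
      ring
  obtain ⟨d, rfl⟩ := Nat.exists_eq_add_of_lt hj
  clear hj
  induction d with
  | zero =>
    have := hlow j le_rfl
    unfold polygonal at this ⊢
    rw [add_zero, Finset.sum_range_succ, ← add_assoc, this, min_eq_right (by linarith [ht.2]),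
      max_eq_right (by linarith [ht.1])]
  | succ d ih =>
    unfold polygonal at ih ⊢
    rw [Finset.sum_range_succ, ← add_assoc, ← add_assoc j d 1, ih, min_eq_right, max_eq_left]
    · simp
    · push_cast; linarith [ht.2, (Nat.cast_nonneg d : (0 : ℝ) ≤ d)]
    · push_cast; linarith [ht.2, (Nat.cast_nonneg d : (0 : ℝ) ≤ d)]

/-- The sequence of nodes `i, i + 1, i, i + 1, i + 2, i + 1, …` of a walk on `ℕ` that crosses each
unit interval three times. -/
def tripleWalk (j : ℕ) : ℕ := j / 3 + j % 3 % 2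

lemma tripleWalk_adj (j : ℕ) :
    tripleWalk (j + 1) = tripleWalk j + 1 ∨ tripleWalk j = tripleWalk (j + 1) + 1 := by
  unfold tripleWalk
  omega

lemma tripleWalk_fold {M j : ℕ} (hj : j < 3 * M) :
    (j + 1 < 3 * M ∧ tripleWalk (j + 2) = tripleWalk j) ∨
      ∃ i, j = i + 1 ∧ tripleWalk (i + 2) = tripleWalk i := by
  rcases Nat.lt_or_ge (j % 3) 2 with h | h
  · by_cases h0 : j % 3 = 0
    · left; unfold tripleWalk; omega
    · exact Or.inr ⟨j - 1, by omega, by unfold tripleWalk; omega⟩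
  · exact Or.inr ⟨j - 1, by omega, by unfold tripleWalk; omega⟩

lemma tripleWalk_mem (j : ℕ) : (tripleWalk j = j / 3 ∨ tripleWalk j = j / 3 + 1) ∧
    (tripleWalk (j + 1) = j / 3 ∨ tripleWalk (j + 1) = j / 3 + 1) := by
  unfold tripleWalk
  omega

/-- The index of a piece `[j / N, (j + 1) / N]` containing `x`. -/
def pieceIndex (N : ℕ) (x : I) : ℕ := min ⌊N * (x : ℝ)⌋₊ (N - 1)

lemma pieceIndex_lt {N : ℕ} (hN : 0 < N) (x : I) : pieceIndex N x < N := by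
  unfold pieceIndex
  omega

lemma mem_piece {N : ℕ} (hN : 0 < N) (x : I) :
    N * (x : ℝ) ∈ Icc (pieceIndex N x : ℝ) (pieceIndex N x + 1) := by
  have hx0 : 0 ≤ N * (x : ℝ) := mul_nonneg (Nat.cast_nonneg _) x.2.1
  constructor
  · exact (Nat.cast_le.2 (min_le_left _ _)).trans (Nat.floor_le hx0)
  · unfold pieceIndex
    rcases min_choice ⌊N * (x : ℝ)⌋₊ (N - 1) with h | h <;> rw [h]
    · exact (Nat.lt_floor_add_one _).le
    · rw [Nat.cast_sub hN]
      have := mul_le_mul_of_nonneg_left x.2.2 (Nat.cast_nonneg N : (0 : ℝ) ≤ N)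
      push_cast
      linarith

/-- The polygonal function rescaled to `[0,1]`. -/
def polygonalI (w : ℕ → ℝ) (N : ℕ) : C(I, ℝ) :=
  ⟨fun x => polygonal w N (N * x), (continuous_polygonal w N).comp (by fun_prop)⟩

section PolygonalI

variable {w : ℕ → ℝ} {N : ℕ}

lemma polygonalI_eq {j : ℕ} (hj : j < N) {x : I} (hx : N * (x : ℝ) ∈ Icc (j : ℝ) (j + 1)) :
    polygonalI w N x = w j + (w (j + 1) - w j) * (N * x - j) :=
  polygonal_eq w hj hx

lemma volume_polygonalI_fiber (hN : 0 < N) (hw : ∀ j, w j ≠ w (j + 1)) (y : ℝ) :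
    volume {z : I | polygonalI w N z = y} = 0 := by
  apply Set.Finite.measure_zero
  refine Finite.of_injOn (f := pieceIndex N) (t := Iio N) (fun x _ => pieceIndex_lt hN x) ?_
    (finite_Iio N)
  intro a ha b hb hab
  have ha' : polygonalI w N a = y := ha
  have hb' : polygonalI w N b = y := hb
  have hb2 := mem_piece hN b
  rw [← hab] at hb2
  rw [polygonalI_eq (pieceIndex_lt hN a) (mem_piece hN a)] at ha'
  rw [polygonalI_eq (pieceIndex_lt hN a) hb2, ← ha'] at hb'
  have h1 := mul_left_cancel₀ (sub_ne_zero.2 (hw (pieceIndex N a)).symm) (add_left_cancel hb')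
  have hN' : (N : ℝ) ≠ 0 := by positivity
  exact Subtype.ext (mul_left_cancel₀ hN' (by linarith))

lemma affine_mem_uIcc (a b : ℝ) {s t u : ℝ} (h1 : s ≤ t) (h2 : t ≤ u) :
    a + b * t ∈ uIcc (a + b * s) (a + b * u) := by
  rw [mem_uIcc]
  rcases le_total 0 b with hb | hb
  · left; constructor <;> nlinarith
  · right; constructor <;> nlinarith

lemma exists_reflected_interval (hN : 0 < N) {j : ℕ} (hj : j < N)
    (hfold : (j + 1 < N ∧ w (j + 2) = w j) ∨ ∃ i, j = i + 1 ∧ w (i + 2) = w i) {x y : I}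
    (hxy : x < y) (hx : (j : ℝ) ≤ N * (x : ℝ)) (hy : N * (y : ℝ) ≤ j + 1) :
    ∃ x' y' : I, (y' : ℝ) - x' = y - x ∧ (y ≤ x' ∨ y' ≤ x) ∧
      Ioo x' y' ⊆ polygonalI w N ⁻¹' uIcc (polygonalI w N x) (polygonalI w N y) := by
  have hN' : (0 : ℝ) < N := by exact_mod_cast hN
  have hxy' : (x : ℝ) < y := hxy
  have hNxy : N * (x : ℝ) ≤ N * y := mul_le_mul_of_nonneg_left hxy'.le hN'.le
  have key : ∀ i c : ℕ, i < N → (∀ t : ℝ, (j : ℝ) ≤ t → t ≤ j + 1 →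
      2 * c - t ∈ Icc (i : ℝ) (i + 1) ∧
      w i + (w (i + 1) - w i) * (2 * c - t - i) = w j + (w (j + 1) - w j) * (t - j)) →
      (N * (y : ℝ) ≤ c ∨ c ≤ N * (x : ℝ)) →
      ∃ x' y' : I, (y' : ℝ) - x' = y - x ∧ (y ≤ x' ∨ y' ≤ x) ∧
      Ioo x' y' ⊆ polygonalI w N ⁻¹' uIcc (polygonalI w N x) (polygonalI w N y) := by
    intro i c hi h hside
    have hi' : (i : ℝ) + 1 ≤ N := by exact_mod_cast hi
    have hi0 : (0 : ℝ) ≤ i := Nat.cast_nonneg i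
    have hmul : ∀ z : ℝ, N * (2 * c / N - z) = 2 * c - N * z := fun z => by field_simp
    have hmem : ∀ z : I, (j : ℝ) ≤ N * (z : ℝ) → N * (z : ℝ) ≤ j + 1 →
        2 * c / N - (z : ℝ) ∈ I := by
      intro z h1 h2
      obtain ⟨⟨h3, h4⟩, -⟩ := h _ h1 h2
      rw [← hmul] at h3 h4
      exact ⟨nonneg_of_mul_nonneg_right (hi0.trans h3) hN',
        le_of_mul_le_mul_left (by linarith : N * (2 * c / N - (z : ℝ)) ≤ N * 1) hN'⟩
    refine ⟨⟨2 * c / N - y, hmem y (hx.trans hNxy) hy⟩,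
      ⟨2 * c / N - x, hmem x hx (hNxy.trans hy)⟩, by simp, ?_, ?_⟩
    · rcases hside with h | h
      · left
        change (y : ℝ) ≤ 2 * c / N - y
        refine le_of_mul_le_mul_left ?_ hN'
        rw [hmul]; linarith
      · right
        change 2 * c / N - (x : ℝ) ≤ x
        refine le_of_mul_le_mul_left ?_ hN'
        rw [hmul]; linarith
    · rintro z ⟨hz1, hz2⟩
      have hz1' : 2 * c / N - (y : ℝ) < z := hz1
      have hz2' : (z : ℝ) < 2 * c / N - x := hz2
      have e1 := mul_lt_mul_of_pos_left hz1' hN'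
      have e2 := mul_lt_mul_of_pos_left hz2' hN'
      rw [hmul] at e1 e2
      obtain ⟨h3, h4⟩ := h (2 * c - N * z) (by linarith) (by linarith)
      rw [sub_sub_cancel] at h3 h4
      rw [mem_preimage, polygonalI_eq hi h3, h4, polygonalI_eq hj ⟨hx, hNxy.trans hy⟩,
        polygonalI_eq hj ⟨hx.trans hNxy, hy⟩]
      exact affine_mem_uIcc _ _ (by linarith) (by linarith)
  rcases hfold with ⟨h1, h2⟩ | ⟨i, rfl, h2⟩
  · refine key (j + 1) (j + 1) h1 (fun t ht1 ht2 => ⟨⟨?_, ?_⟩, ?_⟩) (Or.inl ?_)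
    · push_cast; linarith
    · push_cast; linarith
    · rw [show j + 1 + 1 = j + 2 from rfl, h2]; push_cast; ring
    · push_cast; exact hy
  · refine key i (i + 1) (by omega) (fun t ht1 ht2 => ⟨⟨?_, ?_⟩, ?_⟩) (Or.inr ?_)
    · push_cast at *; linarith
    · push_cast at *; linarith
    · rw [show i + 1 + 1 = i + 2 from rfl, h2]; push_cast; ring
    · push_cast at *; exact hx

lemma lt_volume_preimage_uIcc (hN : 0 < N) {j : ℕ} (hj : j < N)
    (hfold : (j + 1 < N ∧ w (j + 2) = w j) ∨ ∃ i, j = i + 1 ∧ w (i + 2) = w i) {x y : I}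
    (hxy : x < y) (hx : (j : ℝ) ≤ N * (x : ℝ)) (hy : N * (y : ℝ) ≤ j + 1) :
    (y : ℝ) - x <
      volume.real (polygonalI w N ⁻¹' uIcc (polygonalI w N x) (polygonalI w N y)) := by
  have hxy' : (x : ℝ) < y := hxy
  obtain ⟨x', y', hlen, hdisj, hsub⟩ := exists_reflected_interval hN hj hfold hxy hx hy
  have hvol : ∀ a b : I, a ≤ b → volume.real (Ioo a b) = (b : ℝ) - a := fun a b h => by
    rw [measureReal_def, unitInterval.volume_Ioo, ENNReal.toReal_ofReal (sub_nonneg.2 h)]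
  have hN' : (0 : ℝ) < N := by exact_mod_cast hN
  have hsub' : Ioo x y ⊆ polygonalI w N ⁻¹' uIcc (polygonalI w N x) (polygonalI w N y) := by
    rintro z ⟨hz1, hz2⟩
    have e1 := mul_lt_mul_of_pos_left (show (x : ℝ) < z from hz1) hN'
    have e2 := mul_lt_mul_of_pos_left (show (z : ℝ) < y from hz2) hN'
    rw [mem_preimage, polygonalI_eq (x := x) hj ⟨hx, by linarith⟩,
      polygonalI_eq (x := z) hj ⟨by linarith, by linarith⟩,
      polygonalI_eq (x := y) hj ⟨by linarith, hy⟩]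
    exact affine_mem_uIcc _ _ (by linarith) (by linarith)
  have hd : Disjoint (Ioo x y) (Ioo x' y') := by
    rw [Set.disjoint_left]
    rintro z ⟨h1, h2⟩ ⟨h3, h4⟩
    rcases hdisj with h | h
    · exact lt_irrefl _ (h2.trans (h.trans_lt h3))
    · exact lt_irrefl _ (h4.trans (h.trans_lt h1))
  have hx'y' : x' ≤ y' := by
    change (x' : ℝ) ≤ y'
    linarith
  have := measureReal_mono (μ := volume) (union_subset hsub' hsub)
  rw [measureReal_union hd measurableSet_Ioo, hvol _ _ hxy.le, hvol _ _ hx'y'] at this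
  linarith

end PolygonalI

/-- Maps with finitely many periodic points of each period are dense in `C_λ(I)`. -/
lemma exists_measPres_dist_lt_finite_fixSet {f : C(I, I)} (hf : MeasPres f) {r : ℝ} (hr : 0 < r) :
    ∃ g : C(I, I), MeasPres g ∧ dist g f < r ∧ ∀ k, 1 ≤ k → (FixSet g k).Finite := by
  set δ : ℝ := r / 5 with hδdef
  have hδ : 0 < δ := by positivity
  obtain ⟨η, hη, hfη⟩ := Metric.uniformContinuous_iff.1
    (CompactSpace.uniformContinuous_of_continuous f.continuous) δ hδ
  obtain ⟨m, hm⟩ := exists_nat_one_div_lt hη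
  set M : ℕ := m + 1 with hM
  have hM0 : (0 : ℝ) < M := by positivity
  have hMη : 1 / (M : ℝ) < η := by simpa [hM] using hm
  let F : ℝ → ℝ := fun s => f (projIcc 0 1 zero_le_one s)
  have hF : ∀ s t : ℝ, |s - t| ≤ 1 → |F (s / M) - F (t / M)| < δ := by
    intro s t hst
    refine hfη (lt_of_le_of_lt ?_ hMη)
    refine (abs_projIcc_sub_projIcc zero_le_one).trans ?_
    rw [← sub_div, abs_div, abs_of_pos hM0]
    exact div_le_div_of_nonneg_right hst hM0.le
  let u : ℕ → ℝ := fun i => F (i / M) + (-1) ^ i * δ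
  have hu : ∀ i, u i ≠ u (i + 1) := by
    intro i h
    have h1 := abs_lt.1 (hF i (i + 1 : ℕ) (by push_cast; simp))
    simp only [u, pow_succ] at h
    rcases neg_one_pow_eq_or ℝ i with h2 | h2 <;> rw [h2] at h <;> linarith
  let w : ℕ → ℝ := fun j => u (tripleWalk j)
  have hw : ∀ j, w j ≠ w (j + 1) := by
    intro j
    rcases tripleWalk_adj j with h | h
    · simp only [w, h]; exact hu _
    · simp only [w, h]; exact (hu _).symm
  set N : ℕ := 3 * M with hNdef
  have hN : 0 < N := by omega
  have hfold : ∀ j < N, (j + 1 < N ∧ w (j + 2) = w j) ∨ ∃ i, j = i + 1 ∧ w (i + 2) = w i := by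
    intro j hj
    rcases tripleWalk_fold hj with ⟨h1, h2⟩ | ⟨i, h1, h2⟩
    · exact Or.inl ⟨h1, by simp only [w, h2]⟩
    · exact Or.inr ⟨i, h1, by simp only [w, h2]⟩
  set p : C(I, ℝ) := polygonalI w N with hp
  have hatom : ∀ y, volume {z : I | p z = y} = 0 := volume_polygonalI_fiber hN hw
  have hpf : ∀ x, |p x - f x| ≤ 2 * δ := by
    intro x
    set j := pieceIndex N x with hj
    have hmem := mem_piece hN x
    rw [← hj] at hmem
    have hNM : (N : ℝ) = 3 * M := by rw [hNdef]; push_cast; ring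
    have hFx : F (M * x / M) = f x := by
      simp only [F]
      rw [mul_div_cancel_left₀ _ hM0.ne', projIcc_val]
    have hq : (3 * (j / 3 : ℕ) : ℝ) ≤ j ∧ (j : ℝ) + 1 ≤ 3 * ((j / 3 : ℕ) + 1) := by
      constructor
      · exact_mod_cast (by omega : 3 * (j / 3) ≤ j)
      · exact_mod_cast (by omega : j + 1 ≤ 3 * (j / 3 + 1))
    rw [hNM] at hmem
    have hnode : ∀ i : ℕ, i = j / 3 ∨ i = j / 3 + 1 → |u i - f x| ≤ 2 * δ := by
      intro i hi
      have h1 : |F (i / M) - F (M * x / M)| < δ := by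
        apply hF
        rw [abs_le]
        rcases hi with rfl | rfl
        · constructor <;> linarith [hmem.1, hmem.2]
        · push_cast
          constructor <;> linarith [hmem.1, hmem.2]
      rw [hFx, abs_lt] at h1
      simp only [u]
      rw [abs_le]
      rcases neg_one_pow_eq_or ℝ i with h2 | h2 <;> rw [h2] <;> constructor <;> linarith
    have hA := abs_le.1 (hnode _ (tripleWalk_mem j).1)
    have hB := abs_le.1 (hnode _ (tripleWalk_mem j).2)
    rw [hp, polygonalI_eq (pieceIndex_lt hN x) (mem_piece hN x), ← hj]
    have hs0 : 0 ≤ (N : ℝ) * x - j := by rw [hNM]; linarith [hmem.1]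
    have hs1 : (N : ℝ) * x - j ≤ 1 := by rw [hNM]; linarith [hmem.2]
    set s := (N : ℝ) * x - j
    simp only [w]
    rw [abs_le]
    constructor <;> nlinarith
  obtain ⟨g, hg, hgp⟩ := exists_measPres_eq_distributionTransform hatom
  refine ⟨g, hg, ?_, fun k hk => ?_⟩
  · refine lt_of_le_of_lt ((ContinuousMap.dist_le (by positivity : 0 ≤ 4 * δ)).2 fun x => ?_)
      (by rw [hδdef]; linarith : 4 * δ < r)
    rw [Subtype.dist_eq, hgp, Real.dist_eq]
    linarith [abs_distributionTransform_sub_le hf hpf x]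
  · refine finite_fixSet_of_expanding
      (fun x => (⟨pieceIndex N x, pieceIndex_lt hN x⟩ : Fin N)) ?_ hk
    intro x y hne hc
    wlog hxy : x < y generalizing x y
    · rw [dist_comm x, dist_comm (g x)]
      exact this y x hne.symm hc.symm (lt_of_le_of_ne (not_lt.1 hxy) hne.symm)
    have hc' : pieceIndex N x = pieceIndex N y := congrArg Fin.val hc
    have h1 := lt_volume_preimage_uIcc hN (pieceIndex_lt hN x) (hfold _ (pieceIndex_lt hN x)) hxy
      (mem_piece hN x).1 (hc' ▸ (mem_piece hN y).2)
    have h2 := volume_preimage_uIcc_le hatom x y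
    rw [dist_comm x, Subtype.dist_eq, Subtype.dist_eq, Real.dist_eq, Real.dist_eq, hgp, hgp,
      abs_of_pos (sub_pos.2 (show (x : ℝ) < y from hxy))]
    exact h1.trans_le h2

theorem generic_Fix_lowerBoxDim_zero :
    ∃ R : Set ↥CLam, R ∈ residual ↥CLam ∧
      ∀ f ∈ R, ∀ k : ℕ, 1 ≤ k → lowerBoxDim (FixSet (⇑f.1) k) = 0 := by
  let S : ℕ → ℕ → Set ↥CLam := fun k n =>
    {f | 1 ≤ k → SmallAtScale (FixSet (⇑f.1) k) (1 / ((n : ℝ) + 1))}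
  have hS : ∀ k n, S k n ∈ residual ↥CLam := by
    intro k n
    refine mem_of_superset (residual_of_dense_open isOpen_interior ?_) interior_subset
    rw [Metric.dense_iff]
    intro f r hr
    obtain ⟨g, hg, hgf, hfin⟩ := exists_measPres_dist_lt_finite_fixSet f.2 hr
    refine ⟨⟨g, hg⟩, hgf, ?_⟩
    rw [mem_interior_iff_mem_nhds]
    by_cases hk : 1 ≤ k
    · have := eventually_smallAtScale g (hfin k hk) (Nat.one_div_pos_of_nat (α := ℝ) (n := n))
      have h2 : Tendsto (Subtype.val : ↥CLam → C(I, I)) (𝓝 ⟨g, hg⟩) (𝓝 g) :=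
        continuous_subtype_val.continuousAt
      filter_upwards [h2.eventually this] with f hf _ using hf
    · exact Filter.univ_mem' fun f h => absurd h hk
  refine ⟨⋂ k, ⋂ n, S k n,
    countable_iInter_mem.2 fun k => countable_iInter_mem.2 fun n => hS k n, ?_⟩
  intro f hf k hk
  refine lowerBoxDim_eq_zero fun η hη => ?_
  obtain ⟨n, hn⟩ := exists_nat_one_div_lt hη
  obtain ⟨ε, h0, h1, h2, h3⟩ := mem_iInter₂.1 hf k n hk
  exact ⟨ε, h0, h1.trans hn, h2, h3.trans hn.le⟩
end
end

section
/- For a generic map f in C_λ(I) (i.e., for every f in some residual subset of C_λ(I)) and for every integer k ≥ 1, the upper box dimension of the set Per(f,k) = {x ∈ [0,1] : f^k(x) = x and f^i(x) ≠ x for all 1 ≤ i < k} equals one, i.e., limsup_{ε→0⁺} log N(Per(f,k),ε)/log(1/ε) = 1; consequently the upper box dimension of Fix(f,k) = {x : f^k(x) = x} also equals one. -/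
open MeasureTheory Set Metric Filter Topology

noncomputable section

/-- The horseshoe condition: `n` intervals in `[A, B]`, pairwise more than `ε` apart, each of which
is stretched by `f` strictly across `[A, B]`. -/
def HasHorseshoe (f : unitInterval → unitInterval) (n : ℕ) (ε : ℝ) : Prop :=
  ∃ (A B : ℝ) (u v : ℕ → unitInterval),
    (∀ i < n, (u i : ℝ) ∈ Icc A B ∧ (v i : ℝ) ∈ Icc A B ∧ (f (u i) : ℝ) < A ∧ B < f (v i)) ∧
    ∀ i < n, ∀ j < n, i ≠ j → ∀ x ∈ uIcc (u i : ℝ) (v i), ∀ y ∈ uIcc (u j : ℝ) (v j), ε < |x - y|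

lemma exists_subinterval_mapsTo_Icc {g : ℝ → ℝ} (hg : Continuous g) {s t lo hi : ℝ}
    (hlh : lo ≤ hi) (hs : g s ≤ lo) (ht : hi ≤ g t) :
    ∃ s' t', uIcc s' t' ⊆ uIcc s t ∧ g s' = lo ∧ g t' = hi ∧ ∀ x ∈ uIcc s' t', g x ∈ Icc lo hi := by
  let K : Set (ℝ × ℝ) := (uIcc s t ×ˢ uIcc s t) ∩ {p | g p.1 ≤ lo ∧ hi ≤ g p.2}
  have hK : IsCompact K := by
    refine (isCompact_uIcc.prod isCompact_uIcc).inter_right ?_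
    exact (isClosed_le (hg.comp continuous_fst) continuous_const).inter
      (isClosed_le continuous_const (hg.comp continuous_snd))
  have hne : K.Nonempty := ⟨(s, t), ⟨left_mem_uIcc, right_mem_uIcc⟩, hs, ht⟩
  obtain ⟨⟨a, b⟩, ⟨⟨ha, hb⟩, hga, hgb⟩, hmin⟩ :=
    hK.exists_isMinOn hne (f := fun p : ℝ × ℝ => |p.1 - p.2|) (by fun_prop)
  simp only at ha hb hga hgb
  have hsub : uIcc a b ⊆ uIcc s t := uIcc_subset_uIcc ha hb
  have hlo : ∀ x ∈ uIcc a b, g x ≤ lo → x = a := by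
    intro x hx hgx
    have h := hmin (show (x, b) ∈ K from ⟨⟨hsub hx, hb⟩, hgx, hgb⟩)
    simp only [mem_ofPred_eq] at h
    rcases mem_uIcc.1 hx with hx | hx
    · rw [abs_of_nonpos (by linarith), abs_of_nonpos (by linarith)] at h; linarith
    · rw [abs_of_nonneg (by linarith), abs_of_nonneg (by linarith)] at h; linarith
  have hhi : ∀ x ∈ uIcc a b, hi ≤ g x → x = b := by
    intro x hx hgx
    have h := hmin (show (a, x) ∈ K from ⟨⟨ha, hsub hx⟩, hga, hgx⟩)
    simp only [mem_ofPred_eq] at h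
    rcases mem_uIcc.1 hx with hx | hx
    · rw [abs_of_nonpos (by linarith), abs_of_nonpos (by linarith)] at h; linarith
    · rw [abs_of_nonneg (by linarith), abs_of_nonneg (by linarith)] at h; linarith
  have hivt := intermediate_value_uIcc (a := a) (b := b) hg.continuousOn
  have hga' : g a = lo := by
    obtain ⟨x, hx, hgx⟩ := hivt (mem_uIcc_of_le hga (hlh.trans hgb))
    rw [← hlo x hx hgx.le, hgx]
  have hgb' : g b = hi := by
    obtain ⟨x, hx, hgx⟩ := hivt (mem_uIcc_of_le (hga.trans hlh) hgb)
    rw [← hhi x hx hgx.ge, hgx]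
  refine ⟨a, b, hsub, hga', hgb', fun x hx => ⟨?_, ?_⟩⟩
  · by_contra! h
    exact h.ne (hlo x hx h.le ▸ hga')
  · by_contra! h
    exact h.ne' (hhi x hx h.le ▸ hgb')

lemma exists_subinterval_mapsTo_uIcc {g : ℝ → ℝ} (hg : Continuous g) {s t A B u v : ℝ}
    (hs : g s < A) (ht : B < g t) (hu : u ∈ Icc A B) (hv : v ∈ Icc A B) :
    ∃ s' t', uIcc s' t' ⊆ uIcc s t ∧ g s' = u ∧ g t' = v ∧ ∀ x ∈ uIcc s' t', g x ∈ uIcc u v := by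
  rcases le_total u v with h | h
  · obtain ⟨s', t', h1, h2, h3, h4⟩ :=
      exists_subinterval_mapsTo_Icc hg h (hs.le.trans hu.1) (hv.2.trans ht.le)
    exact ⟨s', t', h1, h2, h3, by rwa [uIcc_of_le h]⟩
  · obtain ⟨s', t', h1, h2, h3, h4⟩ :=
      exists_subinterval_mapsTo_Icc hg h (hs.le.trans hv.1) (hu.2.trans ht.le)
    exact ⟨t', s', by rwa [uIcc_comm], h3, h2, by rwa [uIcc_of_ge h, uIcc_comm]⟩

lemma exists_interval_itinerary {F : ℝ → ℝ} (hF : Continuous F) {A B : ℝ} {u v : ℕ → ℝ}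
    (h : ∀ i, u i ∈ Icc A B ∧ v i ∈ Icc A B ∧ F (u i) < A ∧ B < F (v i)) (k : ℕ) :
    ∃ s t, F^[k] s = u k ∧ F^[k] t = v k ∧
      ∀ x ∈ uIcc s t, ∀ i ≤ k, F^[i] x ∈ uIcc (u i) (v i) := by
  induction k with
  | zero => exact ⟨u 0, v 0, rfl, rfl, fun x hx i hi => by simpa [Nat.le_zero.1 hi] using hx⟩
  | succ k ih =>
    obtain ⟨s, t, hs, ht, hx⟩ := ih
    have hs' : F^[k + 1] s < A := by rw [Function.iterate_succ_apply', hs]; exact (h k).2.2.1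
    have ht' : B < F^[k + 1] t := by rw [Function.iterate_succ_apply', ht]; exact (h k).2.2.2
    obtain ⟨s', t', hsub, h1, h2, h3⟩ := exists_subinterval_mapsTo_uIcc
      (hF.iterate (k + 1)) hs' ht' (h (k + 1)).1 (h (k + 1)).2.1
    refine ⟨s', t', h1, h2, fun x hxm i hi => ?_⟩
    rcases Nat.le_succ_iff.1 hi with hi | rfl
    · exact hx x (hsub hxm) i hi
    · exact h3 x hxm

lemma exists_periodic_itinerary {F : ℝ → ℝ} (hF : Continuous F) {A B : ℝ} {u v : ℕ → ℝ}
    (h : ∀ i, u i ∈ Icc A B ∧ v i ∈ Icc A B ∧ F (u i) < A ∧ B < F (v i)) {k : ℕ}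
    (hu : u k = u 0) (hv : v k = v 0) :
    ∃ x, F^[k] x = x ∧ ∀ i ≤ k, F^[i] x ∈ uIcc (u i) (v i) := by
  obtain ⟨s, t, hs, ht, hx⟩ := exists_interval_itinerary hF h k
  have hs0 : s ∈ uIcc (u 0) (v 0) := hx s left_mem_uIcc 0 (Nat.zero_le k)
  have ht0 : t ∈ uIcc (u 0) (v 0) := hx t right_mem_uIcc 0 (Nat.zero_le k)
  have hivt := intermediate_value_uIcc (a := s) (b := t) (f := fun x => F^[k] x - x)
    ((hF.iterate k).sub continuous_id).continuousOn
  have h0 : (0 : ℝ) ∈ uIcc (F^[k] s - s) (F^[k] t - t) := by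
    rw [hs, ht, hu, hv]
    rcases le_total (u 0) (v 0) with h | h
    · rw [uIcc_of_le h] at hs0 ht0
      exact mem_uIcc_of_le (by linarith [hs0.1]) (by linarith [ht0.2])
    · rw [uIcc_of_ge h] at hs0 ht0
      exact mem_uIcc_of_ge (by linarith [ht0.1]) (by linarith [hs0.2])
  obtain ⟨x, hxm, hx0⟩ := hivt h0
  exact ⟨x, sub_eq_zero.1 hx0, hx x hxm⟩

/-- Each of the `n` intervals of a horseshoe, apart from the first `k - 1` ones, contains a point of
least period `k`. -/
lemma HasHorseshoe.exists_separated {f : C(unitInterval, unitInterval)} {n : ℕ} {ε : ℝ}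
    (hf : HasHorseshoe f n ε) (hε : 0 ≤ ε) {k : ℕ} (hk : 1 ≤ k) (hkn : k ≤ n) :
    ∃ p : Fin (n - (k - 1)) → unitInterval, (∀ i, p i ∈ PerSet f k) ∧
      ∀ i j, i ≠ j → ε < dist (p i) (p j) := by
  obtain ⟨A, B, u, v, h1, h2⟩ := hf
  let F : ℝ → ℝ := fun x => f (projIcc 0 1 zero_le_one x)
  have hF : Continuous F := by
    exact continuous_subtype_val.comp (f.continuous.comp continuous_projIcc)
  have hFf : ∀ (x : unitInterval) (i : ℕ), F^[i] (x : ℝ) = f^[i] x := by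
    intro x i
    induction i with
    | zero => rfl
    | succ i ih =>
      rw [Function.iterate_succ_apply', Function.iterate_succ_apply', ih]
      simp only [F, projIcc_val]
  have hex : ∀ j : ℕ, k - 1 ≤ j → j < n →
      ∃ p : unitInterval, p ∈ PerSet f k ∧ (p : ℝ) ∈ uIcc (u j : ℝ) (v j) := by
    intro j hkj hjn
    let c : ℕ → ℕ := fun i => if i = 0 ∨ k ≤ i then j else i - 1
    have hc : ∀ i, c i < n := by
      intro i
      simp only [c]
      split_ifs <;> omega
    have hck : c k = j := by simp [c]
    have hc0 : c 0 = j := by simp [c]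
    obtain ⟨x, hxk, hx⟩ := exists_periodic_itinerary hF (A := A) (B := B)
      (u := fun i => u (c i)) (v := fun i => v (c i)) (k := k)
      (fun i => by
        have := h1 (c i) (hc i)
        refine ⟨this.1, this.2.1, ?_, ?_⟩
        · simpa only [F, projIcc_val] using this.2.2.1
        · simpa only [F, projIcc_val] using this.2.2.2)
      (by rw [hck, hc0]) (by rw [hck, hc0])
    have hxI : x ∈ Icc (0 : ℝ) 1 := by
      obtain ⟨l, rfl⟩ : ∃ l, k = l + 1 := ⟨k - 1, by omega⟩
      rw [← hxk, Function.iterate_succ_apply']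
      exact (f _).2
    have hx0 := hx 0 (Nat.zero_le k)
    rw [hc0] at hx0
    refine ⟨⟨x, hxI⟩, ⟨Subtype.ext ?_, fun i hi hik heq => ?_⟩, hx0⟩
    · rw [← hFf]
      exact hxk
    · have hxi := hx i hik.le
      have hci : c i = i - 1 := by
        simp only [c]
        rw [if_neg (by omega)]
      have hfx : F^[i] x = x := by
        have := hFf ⟨x, hxI⟩ i
        rwa [heq] at this
      rw [hfx, hci] at hxi
      have := h2 j hjn (i - 1) (by omega) (by omega) x hx0 x hxi
      rw [sub_self, abs_zero] at this
      linarith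
  choose p hp hpm using fun i : Fin (n - (k - 1)) =>
    hex (k - 1 + i) (by omega) (by have := i.2; omega)
  refine ⟨p, hp, fun i j hij => ?_⟩
  rw [Subtype.dist_eq, Real.dist_eq]
  have := i.2
  have := j.2
  have hij' : (i : ℕ) ≠ j := fun h => hij (Fin.ext h)
  exact h2 (k - 1 + i) (by omega) (k - 1 + j) (by omega) (by omega) _ (hpm i) _ (hpm j)

lemma exists_unitInterval_cover {ε : ℝ} (hε : 0 < ε) (A : Set unitInterval) :
    ∃ U : Fin (⌊1 / ε⌋₊ + 1) → Set unitInterval,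
      (∀ i, Metric.diam (U i) ≤ ε) ∧ A ⊆ ⋃ i, U i := by
  refine ⟨fun i => {x | (i : ℝ) * ε ≤ x ∧ (x : ℝ) ≤ (i + 1) * ε}, fun i => ?_, fun x _ => ?_⟩
  · refine Metric.diam_le_of_forall_dist_le hε.le fun x hx y hy => ?_
    rw [Subtype.dist_eq, Real.dist_eq, abs_le]
    simp only [mem_ofPred_eq] at hx hy
    constructor <;> nlinarith
  · have h0 : 0 ≤ (x : ℝ) / ε := div_nonneg x.2.1 hε.le
    have hlt : ⌊(x : ℝ) / ε⌋₊ < ⌊1 / ε⌋₊ + 1 :=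
      Nat.lt_succ_of_le (Nat.floor_mono (div_le_div_of_nonneg_right x.2.2 hε.le))
    refine mem_iUnion.2 ⟨⟨_, hlt⟩, ?_, ?_⟩
    · exact (le_div_iff₀ hε).1 (Nat.floor_le h0)
    · exact (div_le_iff₀ hε).1 (Nat.lt_floor_add_one _).le

lemma coverNum_le {ε : ℝ} (hε : 0 < ε) (A : Set unitInterval) :
    (coverNum A ε : ℝ) ≤ 1 / ε + 1 := by
  have h : coverNum A ε ≤ ⌊1 / ε⌋₊ + 1 := Nat.sInf_le (exists_unitInterval_cover hε A)
  have h' : (coverNum A ε : ℝ) ≤ (⌊1 / ε⌋₊ : ℝ) + 1 := by exact_mod_cast h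
  linarith [Nat.floor_le (show (0 : ℝ) ≤ 1 / ε by positivity)]

lemma le_coverNum {ε : ℝ} (hε : 0 < ε) {A : Set unitInterval} {N : ℕ}
    (p : Fin N → unitInterval) (hp : ∀ i, p i ∈ A) (hs : ∀ i j, i ≠ j → ε < dist (p i) (p j)) :
    N ≤ coverNum A ε := by
  obtain ⟨U, hU, hA⟩ := Nat.sInf_mem (s := {n : ℕ | ∃ U : Fin n → Set unitInterval,
    (∀ i, Metric.diam (U i) ≤ ε) ∧ A ⊆ ⋃ i, U i}) ⟨_, exists_unitInterval_cover hε A⟩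
  choose c hc using fun i => mem_iUnion.1 (hA (hp i))
  have hinj : Function.Injective c := by
    intro i j hij
    by_contra hne
    have h := Metric.dist_le_diam_of_mem (Bornology.IsBounded.all (U (c i))) (hc i)
      (hij ▸ hc j)
    linarith [hs i j hne, hU (c i)]
  have hcard := Fintype.card_le_of_injective c hinj
  rwa [Fintype.card_fin, Fintype.card_fin] at hcard

lemma log_coverNum_div_nonneg (A : Set unitInterval) {ε : ℝ} (h0 : 0 < ε) (h1 : ε < 1) :
    0 ≤ Real.log (coverNum A ε) / Real.log (1 / ε) :=
  div_nonneg (Real.log_natCast_nonneg _) (Real.log_nonneg (by rw [le_div_iff₀ h0]; linarith))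

lemma eventually_log_coverNum_div_le (A : Set unitInterval) {b : ℝ} (hb : 1 < b) :
    ∀ᶠ ε in 𝓝[>] (0 : ℝ), Real.log (coverNum A ε) / Real.log (1 / ε) ≤ b := by
  have hlog : Tendsto (fun ε : ℝ => Real.log (1 / ε)) (𝓝[>] 0) atTop := by
    simp only [one_div]
    exact Real.tendsto_log_atTop.comp tendsto_inv_nhdsGT_zero
  filter_upwards [hlog.eventually_ge_atTop (Real.log 2 / (b - 1)), self_mem_nhdsWithin,
    mem_nhdsWithin_of_mem_nhds (Iio_mem_nhds one_pos)] with ε h1 h0 hlt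
  simp only [mem_Ioi, mem_Iio] at h0 hlt
  have hinv : 1 < 1 / ε := by rw [lt_div_iff₀ h0]; linarith
  have hpos : 0 < Real.log (1 / ε) := Real.log_pos hinv
  rw [div_le_iff₀ hpos]
  rw [div_le_iff₀ (by linarith)] at h1
  rcases Nat.eq_zero_or_pos (coverNum A ε) with hz | hz
  · rw [hz, Nat.cast_zero, Real.log_zero]
    positivity
  · have : Real.log (coverNum A ε) ≤ Real.log (2 * (1 / ε)) :=
      Real.log_le_log (by exact_mod_cast hz) (by linarith [coverNum_le h0 A])
    rw [Real.log_mul two_ne_zero (by positivity)] at this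
    nlinarith

lemma upperBoxDim_eq_one {A : Set unitInterval}
    (h : ∀ a < 1, ∃ᶠ ε in 𝓝[>] (0 : ℝ), a ≤ Real.log (coverNum A ε) / Real.log (1 / ε)) :
    upperBoxDim A = 1 := by
  have hbdd : IsBoundedUnder (· ≤ ·) (𝓝[>] (0 : ℝ))
      fun ε => Real.log (coverNum A ε) / Real.log (1 / ε) :=
    ⟨2, eventually_map.2 (eventually_log_coverNum_div_le A one_lt_two)⟩
  have hcobdd : IsCoboundedUnder (· ≤ ·) (𝓝[>] (0 : ℝ))
      fun ε => Real.log (coverNum A ε) / Real.log (1 / ε) := by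
    refine IsBoundedUnder.isCoboundedUnder_le ⟨0, eventually_map.2 ?_⟩
    filter_upwards [self_mem_nhdsWithin, mem_nhdsWithin_of_mem_nhds (Iio_mem_nhds one_pos)]
      with ε h0 h1
    exact log_coverNum_div_nonneg A h0 h1
  refine le_antisymm ?_ ?_
  · refine le_of_forall_gt_imp_ge_of_dense fun b hb => ?_
    exact limsup_le_of_le hcobdd (eventually_log_coverNum_div_le A hb)
  · refine le_of_forall_lt_imp_le_of_dense fun a ha => ?_
    exact le_limsup_of_frequently_le (h a ha) hbdd

lemma volume_preimage_affine {a : ℝ} (ha : a ≠ 0) (b : ℝ) (T : Set ℝ) :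
    volume ((fun x => a * x + b) ⁻¹' T) = ENNReal.ofReal |a⁻¹| * volume T := by
  have : (fun x => a * x + b) ⁻¹' T = (fun x => a * x) ⁻¹' ((fun x => x + b) ⁻¹' T) := rfl
  rw [this, Real.volume_preimage_mul_left ha, measure_preimage_add_right]

/-- The identity of `ℝ` with the graph over `[α, β]` replaced by a three-fold zigzag. -/
def zigzag (α β x : ℝ) : ℝ :=
  x - max α (min β x) + α + |(β - α) - (|3 * (max α (min β x) - α) - (β - α)|)|

lemma continuous_zigzag (α β : ℝ) : Continuous (zigzag α β) := by
  unfold zigzag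
  fun_prop

lemma zigzag_of_notMem {α β x : ℝ} (h : α ≤ β) (hx : x ∉ Icc α β) : zigzag α β x = x := by
  rcases lt_or_ge x α with h1 | h1
  · rw [zigzag, min_eq_right (by linarith), max_eq_left h1.le, sub_self, mul_zero, zero_sub,
      abs_neg, abs_of_nonneg (sub_nonneg.2 h), sub_self, abs_zero]
    ring
  · have h2 : β < x := by
      by_contra! h2
      exact hx ⟨h1, h2⟩
    rw [zigzag, min_eq_left h2.le, max_eq_right h,
      abs_of_nonneg (a := 3 * (β - α) - (β - α)) (by linarith), abs_of_nonpos (by linarith)]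
    ring

lemma zigzag_eq_left {α β x : ℝ} (h1 : α ≤ x) (h2 : x ≤ α + (β - α) / 3) :
    zigzag α β x = 3 * x + -2 * α := by
  rw [zigzag, min_eq_right (by linarith), max_eq_right h1,
    abs_of_nonpos (a := 3 * (x - α) - (β - α)) (by linarith), abs_of_nonneg (by linarith)]
  ring

lemma zigzag_eq_mid {α β x : ℝ} (h : α ≤ β) (h1 : α + (β - α) / 3 ≤ x)
    (h2 : x ≤ α + 2 * (β - α) / 3) :
    zigzag α β x = -3 * x + (2 * α + 2 * β) := by
  rw [zigzag, min_eq_right (by linarith), max_eq_right (by linarith),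
    abs_of_nonneg (a := 3 * (x - α) - (β - α)) (by linarith), abs_of_nonneg (by linarith)]
  ring

lemma zigzag_eq_right {α β x : ℝ} (h : α ≤ β) (h1 : α + 2 * (β - α) / 3 ≤ x) (h2 : x ≤ β) :
    zigzag α β x = 3 * x + -2 * β := by
  rw [zigzag, min_eq_right h2, max_eq_right (by linarith),
    abs_of_nonneg (a := 3 * (x - α) - (β - α)) (by linarith), abs_of_nonpos (by linarith)]
  ring

lemma zigzag_mem {α β x : ℝ} (h : α ≤ β) (hx : x ∈ Icc α β) : zigzag α β x ∈ Icc α β := by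
  obtain ⟨h1, h2⟩ := hx
  rcases le_total x (α + (β - α) / 3) with h3 | h3
  · rw [zigzag_eq_left h1 h3]
    constructor <;> linarith
  rcases le_total x (α + 2 * (β - α) / 3) with h4 | h4
  · rw [zigzag_eq_mid h h3 h4]
    constructor <;> linarith
  · rw [zigzag_eq_right h h4 h2]
    constructor <;> linarith

lemma volume_preimage_zigzag {α β : ℝ} (h : α < β) {S : Set ℝ} (hS : MeasurableSet S) :
    volume (zigzag α β ⁻¹' S) = volume S := by
  have hm : MeasurableSet (zigzag α β ⁻¹' S) := (continuous_zigzag α β).measurable hS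
  set p := α + (β - α) / 3 with hp
  set q := α + 2 * (β - α) / 3 with hq
  have e1 : zigzag α β ⁻¹' S ∩ Icc α p = (fun x => 3 * x + -2 * α) ⁻¹' (S ∩ Icc α β) := by
    ext x
    simp only [mem_inter_iff, mem_preimage, mem_Icc]
    constructor
    · rintro ⟨hx, h1, h2⟩
      rw [zigzag_eq_left h1 h2] at hx
      exact ⟨hx, by linarith, by linarith⟩
    · rintro ⟨hx, h1, h2⟩
      have h1' : α ≤ x := by linarith
      have h2' : x ≤ p := by linarith
      exact ⟨by rwa [zigzag_eq_left h1' h2'], h1', h2'⟩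
  have e2 : zigzag α β ⁻¹' S ∩ Icc p q =
      (fun x => -3 * x + (2 * α + 2 * β)) ⁻¹' (S ∩ Icc α β) := by
    ext x
    simp only [mem_inter_iff, mem_preimage, mem_Icc]
    constructor
    · rintro ⟨hx, h1, h2⟩
      rw [zigzag_eq_mid h.le h1 h2] at hx
      exact ⟨hx, by linarith, by linarith⟩
    · rintro ⟨hx, h1, h2⟩
      have h1' : p ≤ x := by linarith
      have h2' : x ≤ q := by linarith
      exact ⟨by rwa [zigzag_eq_mid h.le h1' h2'], h1', h2'⟩
  have e3 : zigzag α β ⁻¹' S ∩ Icc q β = (fun x => 3 * x + -2 * β) ⁻¹' (S ∩ Icc α β) := by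
    ext x
    simp only [mem_inter_iff, mem_preimage, mem_Icc]
    constructor
    · rintro ⟨hx, h1, h2⟩
      rw [zigzag_eq_right h.le h1 h2] at hx
      exact ⟨hx, by linarith, by linarith⟩
    · rintro ⟨hx, h1, h2⟩
      have h1' : q ≤ x := by linarith
      have h2' : x ≤ β := by linarith
      exact ⟨by rwa [zigzag_eq_right h.le h1' h2'], h1', h2'⟩
  have e4 : zigzag α β ⁻¹' S \ Icc α β = S \ Icc α β := by
    ext x
    simp only [Set.mem_sdiff, mem_preimage]
    refine and_congr_left fun hx => ?_
    rw [zigzag_of_notMem h.le hx]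
  have hpart : zigzag α β ⁻¹' S ∩ Icc α β = (zigzag α β ⁻¹' S ∩ Icc α p) ∪
      ((zigzag α β ⁻¹' S ∩ Icc p q) ∪ (zigzag α β ⁻¹' S ∩ Icc q β)) := by
    rw [← inter_union_distrib_left, ← inter_union_distrib_left,
      Icc_union_Icc_eq_Icc (by linarith) (by linarith),
      Icc_union_Icc_eq_Icc (by linarith) (by linarith)]
  have hnull : ∀ {a b c : ℝ},
      AEDisjoint volume (zigzag α β ⁻¹' S ∩ Icc a b) (zigzag α β ⁻¹' S ∩ Icc b c) := by
    intro a b c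
    refine measure_mono_null (t := {b}) ?_ (measure_singleton b)
    rintro x ⟨⟨-, -, h1⟩, -, h2, -⟩
    exact le_antisymm h1 h2
  have h3 : (3 : ℝ) ≠ 0 := by norm_num
  have h3' : (-3 : ℝ) ≠ 0 := by norm_num
  have hthird : ENNReal.ofReal |(3 : ℝ)⁻¹| = 3⁻¹ := by
    rw [abs_of_pos (by norm_num), ENNReal.ofReal_inv_of_pos (by norm_num)]
    norm_num
  have hthird' : ENNReal.ofReal |(-3 : ℝ)⁻¹| = 3⁻¹ := by
    rw [inv_neg, abs_neg, hthird]
  have hin : volume (zigzag α β ⁻¹' S ∩ Icc α β) = volume (S ∩ Icc α β) := by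
    rw [hpart, measure_union₀ ((hm.inter measurableSet_Icc).union
        (hm.inter measurableSet_Icc)).nullMeasurableSet,
      measure_union₀ (hm.inter measurableSet_Icc).nullMeasurableSet
        hnull, e1, e2, e3, volume_preimage_affine h3,
      volume_preimage_affine h3, volume_preimage_affine h3', hthird, hthird', ← add_mul,
      ← add_mul]
    · have : (3⁻¹ + (3⁻¹ + 3⁻¹) : ENNReal) = 1 := by
        rw [← add_assoc, ENNReal.inv_three_add_inv_three]
      rw [this, one_mul]
    · rw [← inter_union_distrib_left, Icc_union_Icc_eq_Icc (by linarith) (by linarith)]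
      exact hnull
  rw [← measure_inter_add_sdiff (zigzag α β ⁻¹' S) (measurableSet_Icc (a := α) (b := β)), hin, e4,
    measure_inter_add_sdiff S measurableSet_Icc]

lemma lebI_apply (S : Set unitInterval) : lebI S = volume (Subtype.val '' S) :=
  (MeasurableEmbedding.subtype_coe measurableSet_Icc).comap_apply _ _

lemma MeasPres.comp {f g : C(unitInterval, unitInterval)} (hf : MeasPres f) (hg : MeasPres g) :
    MeasPres (f.comp g) := fun A hA => by
  rw [ContinuousMap.coe_comp, preimage_comp, hg _ (f.continuous.measurable hA), hf A hA]

lemma exists_measPres_zigzag {α β : ℝ} (h : α < β) (hα : 0 ≤ α) (hβ : β ≤ 1) :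
    ∃ H : C(unitInterval, unitInterval), MeasPres H ∧ ∀ x, (H x : ℝ) = zigzag α β x := by
  have hmem : ∀ x : ℝ, zigzag α β x ∈ Icc (0 : ℝ) 1 ↔ x ∈ Icc (0 : ℝ) 1 := by
    intro x
    by_cases hx : x ∈ Icc α β
    · have := zigzag_mem h.le hx
      exact iff_of_true ⟨hα.trans this.1, this.2.trans hβ⟩ ⟨hα.trans hx.1, hx.2.trans hβ⟩
    · rw [zigzag_of_notMem h.le hx]
  refine ⟨⟨fun x => ⟨zigzag α β x, (hmem x).2 x.2⟩,
    ((continuous_zigzag α β).comp continuous_subtype_val).subtype_mk _⟩, fun A hA => ?_,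
    fun x => rfl⟩
  rw [lebI_apply, lebI_apply, ← volume_preimage_zigzag h
    ((MeasurableEmbedding.subtype_coe measurableSet_Icc).measurableSet_image.2 hA)]
  congr 1
  ext x
  constructor
  · rintro ⟨y, hy, rfl⟩
    exact ⟨_, hy, rfl⟩
  · rintro ⟨y, hy, hyx⟩
    have hx : x ∈ Icc (0 : ℝ) 1 := (hmem x).1 (hyx ▸ y.2)
    refine ⟨⟨x, hx⟩, ?_, rfl⟩
    have : (⟨zigzag α β x, (hmem x).2 hx⟩ : unitInterval) = y := Subtype.ext hyx.symm
    exact mem_preimage.2 (by simpa [this] using hy)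

/-- Measure preserving maps of `[0, 1]` which are the identity off `[α, β]` and map each of the `3 ^ j`
intervals of an equipartition of `[α, β]` onto `[α, β]`. -/
lemma exists_measPres_fold {α β : ℝ} (h : α < β) (hα : 0 ≤ α) (hβ : β ≤ 1) (j : ℕ) :
    ∃ H : C(unitInterval, unitInterval), MeasPres H ∧
      (∀ x : unitInterval, (x : ℝ) ∉ Icc α β → H x = x) ∧
      (∀ x : unitInterval, (x : ℝ) ∈ Icc α β → (H x : ℝ) ∈ Icc α β) ∧
      ∀ i : ℕ, i < 3 ^ j → ∀ y : unitInterval, (y : ℝ) ∈ Icc α β → ∃ x : unitInterval, H x = y ∧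
        (x : ℝ) ∈ Icc (α + i * ((β - α) / 3 ^ j)) (α + (i + 1) * ((β - α) / 3 ^ j)) := by
  induction j with
  | zero =>
    refine ⟨ContinuousMap.id _, fun A _ => rfl, fun x _ => rfl, fun x hx => hx,
      fun i hi y hy => ⟨y, rfl, ?_⟩⟩
    obtain rfl : i = 0 := by simpa using hi
    simpa using hy
  | succ j ih =>
    obtain ⟨G, hG, hGoff, hGon, hGs⟩ := ih
    obtain ⟨Z, hZ, hZe⟩ := exists_measPres_zigzag h hα hβ
    refine ⟨G.comp Z, hG.comp hZ, fun x hx => ?_, fun x hx => ?_, fun i hi y hy => ?_⟩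
    · have : Z x = x := Subtype.ext (by rw [hZe, zigzag_of_notMem h.le hx])
      rw [ContinuousMap.comp_apply, this, hGoff x hx]
    · exact hGon _ (by rw [hZe]; exact zigzag_mem h.le hx)
    · set l := (β - α) / 3 ^ (j + 1) with hl
      have h3 : (β - α) / 3 ^ j = 3 * l := by rw [hl, pow_succ]; field_simp
      have hL : β - α = 3 * l * 3 ^ j := by rw [← h3]; field_simp
      have hlpos : 0 < l := div_pos (by linarith) (by positivity)
      rw [pow_succ] at hi
      have hN : 0 < 3 ^ j := by positivity
      have hfin : ∀ z : ℝ, z ∈ Icc α β → ∀ w : unitInterval, zigzag α β z = w → G w = y →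
          z ∈ Icc (α + i * l) (α + (i + 1) * l) → ∃ x : unitInterval, G.comp Z x = y ∧
            (x : ℝ) ∈ Icc (α + i * l) (α + (i + 1) * l) := by
        intro z hz w hzw hwy hzm
        refine ⟨⟨z, hα.trans hz.1, hz.2.trans hβ⟩, ?_, hzm⟩
        rw [← hwy, ContinuousMap.comp_apply]
        congr 1
        exact Subtype.ext (by rw [hZe, ← hzw])
      rcases lt_or_ge i (3 ^ j) with h1 | h1
      · obtain ⟨w, hw, hw1, hw2⟩ := hGs i h1 y hy
        rw [h3] at hw1 hw2
        have hi0 : (0 : ℝ) ≤ i * l := by positivity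
        have hi1 : ((i : ℝ) + 1) * l ≤ 3 ^ j * l := by
          refine mul_le_mul_of_nonneg_right ?_ hlpos.le
          exact_mod_cast h1
        refine hfin ((w + 2 * α) / 3) ⟨by linarith, by linarith⟩ w ?_ hw ⟨by linarith, by linarith⟩
        rw [zigzag_eq_left (by linarith) (by linarith)]
        ring
      rcases lt_or_ge i (2 * 3 ^ j) with h2 | h2
      · obtain ⟨m, hm⟩ : ∃ m, i + m + 1 = 2 * 3 ^ j := ⟨2 * 3 ^ j - 1 - i, by omega⟩
        obtain ⟨w, hw, hw1, hw2⟩ := hGs m (by omega) y hy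
        rw [h3] at hw1 hw2
        have hmr : (m : ℝ) * l = 2 * (3 ^ j * l) - i * l - l := by
          have : (i : ℝ) + m + 1 = 2 * 3 ^ j := by exact_mod_cast hm
          linear_combination l * this
        have hi0 : (3 : ℝ) ^ j * l ≤ i * l := by
          refine mul_le_mul_of_nonneg_right ?_ hlpos.le
          exact_mod_cast h1
        have hi1 : ((i : ℝ) + 1) * l ≤ 2 * 3 ^ j * l := by
          refine mul_le_mul_of_nonneg_right ?_ hlpos.le
          exact_mod_cast h2
        refine hfin ((2 * α + 2 * β - w) / 3) ⟨by linarith, by linarith⟩ w ?_ hw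
          ⟨by linarith, by linarith⟩
        rw [zigzag_eq_mid h.le (by linarith) (by linarith)]
        ring
      · obtain ⟨m, hm⟩ : ∃ m, i = m + 2 * 3 ^ j := ⟨i - 2 * 3 ^ j, by omega⟩
        obtain ⟨w, hw, hw1, hw2⟩ := hGs m (by omega) y hy
        rw [h3] at hw1 hw2
        have hmr : (m : ℝ) * l = i * l - 2 * (3 ^ j * l) := by
          have : (i : ℝ) = m + 2 * 3 ^ j := by exact_mod_cast hm
          linear_combination -l * this
        have hi0 : 0 ≤ (m : ℝ) * l := by positivity
        have hi1 : ((i : ℝ) + 1) * l ≤ 3 ^ j * 3 * l := by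
          refine mul_le_mul_of_nonneg_right ?_ hlpos.le
          exact_mod_cast hi
        refine hfin ((w + 2 * β) / 3) ⟨by linarith, by linarith⟩ w ?_ hw
          ⟨by linarith, by linarith⟩
        rw [zigzag_eq_right h.le (by linarith) (by linarith)]
        ring

lemma MeasPres.exists_apply_ne {f : C(unitInterval, unitInterval)} (hf : MeasPres f) {α β : ℝ}
    (h : α < β) (hα : 0 ≤ α) (hβ : β ≤ 1) (p : unitInterval) :
    ∃ t : unitInterval, (t : ℝ) ∈ Icc α β ∧ f t ≠ p := by
  by_contra! hcon
  have h0 : lebI (f ⁻¹' {p}) = 0 := by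
    rw [hf _ (measurableSet_singleton p), lebI_apply, image_singleton, Real.volume_singleton]
  rw [lebI_apply] at h0
  have hsub : Icc α β ⊆ Subtype.val '' (f ⁻¹' {p}) := fun x hx =>
    ⟨⟨x, hα.trans hx.1, hx.2.trans hβ⟩, hcon _ hx, rfl⟩
  have := measure_mono_null hsub h0
  rw [Real.volume_Icc, ENNReal.ofReal_eq_zero] at this
  linarith

/-- If `f` moves two points of `[α, β]` strictly apart across `[A, B] ⊆ [α, β]`, precomposition with
a fold of `[α, β]` creates a horseshoe. -/
lemma hasHorseshoe_comp_fold {f H : C(unitInterval, unitInterval)} {α β A B l : ℝ}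
    {N n : ℕ} {s t : unitInterval} (hs : (s : ℝ) ∈ Icc α β) (ht : (t : ℝ) ∈ Icc α β)
    (hA : α ≤ A) (hB : B ≤ β) (hfs : (f s : ℝ) < A) (hft : B < f t) (hl : 0 < l)
    (hN : N * l = β - α)
    (hH : ∀ i : ℕ, i < N → ∀ y : unitInterval, (y : ℝ) ∈ Icc α β → ∃ x : unitInterval, H x = y ∧
      (x : ℝ) ∈ Icc (α + i * l) (α + (i + 1) * l))
    (hn : n * (2 * l) ≤ B - A) : HasHorseshoe (f.comp H) n (l / 2) := by
  set a := ⌈(A - α) / l⌉₊ with ha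
  have ha1 : A ≤ α + a * l := by
    have := (div_le_iff₀ hl).1 (Nat.le_ceil ((A - α) / l))
    linarith
  have ha2 : α + a * l < A + l := by
    have h1 := Nat.ceil_lt_add_one (div_nonneg (sub_nonneg.2 hA) hl.le)
    have h2 : (a : ℝ) * l < ((A - α) / l + 1) * l := mul_lt_mul_of_pos_right h1 hl
    rw [add_mul, div_mul_cancel₀ _ hl.ne'] at h2
    linarith
  have hpiece : ∀ k : ℕ, k < n → α + ((a + 2 * k : ℕ) + 1) * l ≤ B := by
    intro k hk
    have h1 : ((k : ℝ) + 1) * (2 * l) ≤ n * (2 * l) :=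
      mul_le_mul_of_nonneg_right (by exact_mod_cast hk) (by linarith)
    push_cast
    linarith
  have hlt : ∀ k : ℕ, k < n → a + 2 * k < N := by
    intro k hk
    have h1 : (((a + 2 * k : ℕ) : ℝ) + 1) * l ≤ N * l := by linarith [hpiece k hk]
    have h2 := le_of_mul_le_mul_right h1 hl
    exact_mod_cast h2
  choose! u hu hum using fun k (hk : k < n) => hH (a + 2 * k) (hlt k hk) s hs
  choose! v hv hvm using fun k (hk : k < n) => hH (a + 2 * k) (hlt k hk) t ht
  have hAk : ∀ k : ℕ, A ≤ α + (a + 2 * k : ℕ) * l := by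
    intro k
    have : 0 ≤ (k : ℝ) * l := by positivity
    push_cast
    linarith
  have hsep : ∀ i < n, ∀ j < n, i < j → ∀ x ∈ uIcc (u i : ℝ) (v i), ∀ y ∈ uIcc (u j : ℝ) (v j),
      l / 2 < y - x := by
    intro i hi j hj hij x hx y hy
    have hx' := (uIcc_subset_Icc (hum i hi) (hvm i hi) hx).2
    have hy' := (uIcc_subset_Icc (hum j hj) (hvm j hj) hy).1
    have h1 : ((i : ℝ) + 1) * l ≤ j * l :=
      mul_le_mul_of_nonneg_right (by exact_mod_cast hij) hl.le
    push_cast at hx' hy'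
    linarith
  refine ⟨A, B, u, v, fun i hi => ⟨?_, ?_, ?_, ?_⟩, fun i hi j hj hij x hx y hy => ?_⟩
  · exact ⟨(hAk i).trans (hum i hi).1, (hum i hi).2.trans (hpiece i hi)⟩
  · exact ⟨(hAk i).trans (hvm i hi).1, (hvm i hi).2.trans (hpiece i hi)⟩
  · rwa [ContinuousMap.comp_apply, hu i hi]
  · rwa [ContinuousMap.comp_apply, hv i hi]
  · rcases lt_or_gt_of_ne hij with h | h
    · rw [abs_sub_comm]
      exact (hsep i hi j hj h x hx y hy).trans_le (le_abs_self _)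
    · exact (hsep j hj i hi h y hy x hx).trans_le (le_abs_self _)

lemma exists_fold_scale {L D δ : ℝ} (hL : 0 < L) (hD : 0 < D) (hδ : 0 < δ) (m : ℕ) :
    ∃ j n : ℕ, n * (2 * (L / 3 ^ j)) ≤ D ∧ m ≤ n ∧ L / 3 ^ j / 2 < δ ∧
      (1 - δ) * Real.log (1 / (L / 3 ^ j / 2)) ≤ Real.log n := by
  have htend : Tendsto (fun j : ℕ => 2 / L * (3 : ℝ) ^ j) atTop atTop :=
    (tendsto_pow_atTop_atTop_of_one_lt (by norm_num)).const_mul_atTop (by positivity)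
  obtain ⟨j, h1, h2, h3⟩ := ((htend.eventually_gt_atTop (1 / δ)).and
    ((htend.eventually_ge_atTop (8 * (m + 1) / D)).and
      ((Real.tendsto_log_atTop.comp htend).eventually_ge_atTop (-Real.log (D / 8) / δ)))).exists
  set l := L / 3 ^ j with hl
  have hlpos : 0 < l := by positivity
  have hE : 2 / L * (3 : ℝ) ^ j = 1 / (l / 2) := by
    rw [hl]
    field_simp
  simp only [Function.comp_apply] at h3
  rw [hE] at h1 h2 h3
  set E := 1 / (l / 2) with hEdef
  have hEpos : 0 < E := by positivity
  have hDl : D / (2 * l) = 2 * (D / 8 * E) := by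
    rw [hEdef]
    field_simp
    norm_num
  have hDE : (m : ℝ) + 1 ≤ D / 8 * E := by
    rw [div_le_iff₀ hD] at h2
    linarith
  have hm : (0 : ℝ) ≤ m := m.cast_nonneg
  have hfloor : D / 8 * E ≤ ⌊D / (2 * l)⌋₊ := by
    have := Nat.lt_floor_add_one (D / (2 * l))
    rw [hDl] at this ⊢
    linarith
  refine ⟨j, ⌊D / (2 * l)⌋₊, ?_, ?_, ?_, ?_⟩
  · exact (le_div_iff₀ (by positivity)).1 (Nat.floor_le (by positivity))
  · have : (m : ℝ) ≤ ⌊D / (2 * l)⌋₊ := by linarith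
    exact_mod_cast this
  · exact (one_div_lt_one_div hδ (by positivity)).1 h1
  · rw [div_le_iff₀ hδ] at h3
    have hlog := Real.log_le_log (by linarith) hfloor
    rw [Real.log_mul (by positivity) hEpos.ne'] at hlog
    change (1 - δ) * Real.log E ≤ _
    linarith

lemma exists_stretched_interval {f : C(unitInterval, unitInterval)} (hf : MeasPres f) {α β : ℝ}
    (h : α < β) (hα : 0 ≤ α) (hβ : β ≤ 1) {p : unitInterval} (hp : f p = p)
    (hpm : (p : ℝ) ∈ Icc α β) (hp0 : 0 < (p : ℝ) → α < p) (hp1 : (p : ℝ) < 1 → (p : ℝ) < β) :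
    ∃ (A B : ℝ) (s t : unitInterval), α ≤ A ∧ A < B ∧ B ≤ β ∧ (s : ℝ) ∈ Icc α β ∧
      (t : ℝ) ∈ Icc α β ∧ (f s : ℝ) < A ∧ B < f t := by
  obtain ⟨q, hq, hqp⟩ := hf.exists_apply_ne h hα hβ p
  rcases lt_or_gt_of_ne hqp with hlt | hlt
  · have hlt' : (f q : ℝ) < p := hlt
    have hM : max (f q : ℝ) α < p := max_lt hlt' (hp0 ((f q).2.1.trans_lt hlt'))
    have h1 := le_max_left (f q : ℝ) α
    have h2 := le_max_right (f q : ℝ) α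
    have h3 := hpm.2
    exact ⟨(2 * max (f q : ℝ) α + p) / 3, (max (f q : ℝ) α + 2 * p) / 3, q, p, by linarith,
      by linarith, by linarith, hq, hpm, by linarith, by rw [hp]; linarith⟩
  · have hlt' : (p : ℝ) < f q := hlt
    have hM : (p : ℝ) < min (f q : ℝ) β := lt_min hlt' (hp1 (hlt'.trans_le (f q).2.2))
    have h1 := min_le_left (f q : ℝ) β
    have h2 := min_le_right (f q : ℝ) β
    have h3 := hpm.1
    exact ⟨(min (f q : ℝ) β + 2 * p) / 3, (2 * min (f q : ℝ) β + p) / 3, p, q, by linarith,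
      by linarith, by linarith, hpm, hq, by rw [hp]; linarith, by linarith⟩

lemma MeasPres.exists_horseshoe_near {f : C(unitInterval, unitInterval)} (hf : MeasPres f)
    {η δ : ℝ} (hη : 0 < η) (hδ : 0 < δ) (m : ℕ) :
    ∃ g, MeasPres g ∧ dist g f < η ∧ ∃ (n : ℕ) (ε : ℝ), m ≤ n ∧ 0 < ε ∧ ε < δ ∧
      (1 - δ) * Real.log (1 / ε) ≤ Real.log n ∧ HasHorseshoe g n ε := by
  obtain ⟨p, -, hp⟩ := exists_mem_uIcc_isFixedPt (f := f) (a := 0) (b := 1)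
    f.continuous.continuousOn unitInterval.nonneg' unitInterval.le_one'
  replace hp : f p = p := hp
  obtain ⟨r, hr, hrf⟩ := Metric.uniformContinuous_iff.1
    (CompactSpace.uniformContinuous_of_continuous f.continuous) η hη
  have hp0 := p.2.1
  have hp1 := p.2.2
  set α := max 0 ((p : ℝ) - r / 3) with hα
  set β := min 1 ((p : ℝ) + r / 3) with hβ
  have hα1 : (p : ℝ) - r / 3 ≤ α := le_max_right _ _
  have hβ1 : β ≤ (p : ℝ) + r / 3 := min_le_right _ _
  have hα0 : 0 ≤ α := le_max_left _ _
  have hβ0 : β ≤ 1 := min_le_left _ _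
  have hαp : α ≤ p := max_le hp0 (by linarith)
  have hpβ : (p : ℝ) ≤ β := le_min hp1 (by linarith)
  have hαp' : 0 < (p : ℝ) → α < p := fun h => max_lt h (by linarith)
  have hpβ' : (p : ℝ) < 1 → (p : ℝ) < β := fun h => lt_min h (by linarith)
  have hαβ : α < β := by
    rcases hp0.lt_or_eq with h | h
    · exact (hαp' h).trans_le hpβ
    · exact hαp.trans_lt (hpβ' (by linarith))
  obtain ⟨A, B, s, t, hA, hAB, hB, hs, ht, hfs, hft⟩ :=
    exists_stretched_interval hf hαβ hα0 hβ0 hp ⟨hαp, hpβ⟩ hαp' hpβ'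
  obtain ⟨j, n, hn, hmn, hε, hlog⟩ := exists_fold_scale (sub_pos.2 hαβ) (sub_pos.2 hAB) hδ m
  obtain ⟨H, hH, hoff, hon, hfold⟩ := exists_measPres_fold hαβ hα0 hβ0 j
  have hl : 0 < (β - α) / 3 ^ j := div_pos (sub_pos.2 hαβ) (by positivity)
  refine ⟨f.comp H, hf.comp hH, ?_, n, (β - α) / 3 ^ j / 2, hmn, half_pos hl, hε, hlog,
    hasHorseshoe_comp_fold hs ht hA hB hfs hft hl (N := 3 ^ j) ?_ hfold hn⟩
  · refine (ContinuousMap.dist_lt_iff hη).2 fun x => ?_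
    by_cases hx : (x : ℝ) ∈ Icc α β
    · refine hrf ?_
      have hHx := hon x hx
      rw [Subtype.dist_eq, Real.dist_eq, abs_lt]
      constructor <;> linarith [hx.1, hx.2, hHx.1, hHx.2]
    · rw [ContinuousMap.comp_apply, hoff x hx, dist_self]
      exact hη
  · push_cast
    field_simp

lemma isOpen_hasHorseshoe (n : ℕ) (ε : ℝ) :
    IsOpen {f : C(unitInterval, unitInterval) | HasHorseshoe f n ε} := by
  refine isOpen_iff_mem_nhds.2 fun f ⟨A, B, u, v, h1, h2⟩ => ?_
  have hev : ∀ i ∈ {i | i < n}, ∀ᶠ g : C(unitInterval, unitInterval) in 𝓝 f,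
      (g (u i) : ℝ) < A ∧ B < g (v i) := by
    intro i hi
    have hc : ∀ x, Continuous fun g : C(unitInterval, unitInterval) => (g x : ℝ) := fun x =>
      continuous_subtype_val.comp (continuous_eval_const x)
    exact ((hc (u i)).continuousAt.eventually_lt_const (h1 i hi).2.2.1).and
      ((hc (v i)).continuousAt.eventually_const_lt (h1 i hi).2.2.2)
  filter_upwards [(Filter.eventually_all_finite (finite_lt_nat n)).2 hev] with g hg
  exact ⟨A, B, u, v, fun i hi => ⟨(h1 i hi).1, (h1 i hi).2.1, hg i hi⟩, h2⟩

/-- Maps with a horseshoe of at least `m` intervals, separated at a small scale `ε` and numbering at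
least `ε ^ (-1 + 1 / (m + 1))`. -/
def horseshoeMaps (m : ℕ) : Set C(unitInterval, unitInterval) :=
  ⋃ (n : ℕ) (ε : ℝ) (_ : m ≤ n ∧ 0 < ε ∧ ε < 1 / ((m : ℝ) + 1) ∧
    (1 - 1 / ((m : ℝ) + 1)) * Real.log (1 / ε) ≤ Real.log n), {f | HasHorseshoe f n ε}

lemma isOpen_horseshoeMaps (m : ℕ) : IsOpen (horseshoeMaps m) :=
  isOpen_iUnion fun n => isOpen_iUnion fun ε => isOpen_iUnion fun _ => isOpen_hasHorseshoe n ε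

lemma mem_horseshoeMaps {m : ℕ} {f : C(unitInterval, unitInterval)} :
    f ∈ horseshoeMaps m ↔ ∃ (n : ℕ) (ε : ℝ), m ≤ n ∧ 0 < ε ∧ ε < 1 / ((m : ℝ) + 1) ∧
      (1 - 1 / ((m : ℝ) + 1)) * Real.log (1 / ε) ≤ Real.log n ∧ HasHorseshoe f n ε := by
  simp only [horseshoeMaps, mem_iUnion, exists_prop, mem_ofPred_eq, and_assoc]

lemma dense_horseshoeMaps (m : ℕ) : Dense ((↑) ⁻¹' horseshoeMaps m : Set ↥CLam) := by
  refine Metric.dense_iff.2 fun f η hη => ?_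
  obtain ⟨g, hg, hd, h⟩ := MeasPres.exists_horseshoe_near f.2 hη (δ := 1 / ((m : ℝ) + 1))
    (by positivity) m
  exact ⟨⟨g, hg⟩, hd, mem_horseshoeMaps.2 h⟩

lemma frequently_le_log_coverNum_div {f : C(unitInterval, unitInterval)}
    (hf : ∀ m, f ∈ horseshoeMaps m) {k : ℕ} (hk : 1 ≤ k) {A : Set unitInterval}
    (hA : PerSet f k ⊆ A) {a : ℝ} (ha : a < 1) :
    ∃ᶠ ε in 𝓝[>] (0 : ℝ), a ≤ Real.log (coverNum A ε) / Real.log (1 / ε) := by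
  refine Filter.frequently_iff.2 fun {S} hS => ?_
  obtain ⟨b, hb, hbS⟩ := mem_nhdsGT_iff_exists_Ioo_subset.1 hS
  have hcast : Tendsto (fun m : ℕ => (m : ℝ) + 1) atTop atTop :=
    tendsto_atTop_add_const_right _ _ tendsto_natCast_atTop_atTop
  have hinv : Tendsto (fun m : ℕ => 1 / ((m : ℝ) + 1)) atTop (𝓝 0) :=
    tendsto_one_div_add_atTop_nhds_zero_nat
  have hlim : Tendsto (fun m : ℕ => 1 - 1 / ((m : ℝ) + 1) - Real.log 2 / Real.log ((m : ℝ) + 1))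
      atTop (𝓝 (1 - 0 - 0)) :=
    (tendsto_const_nhds.sub hinv).sub
      ((Real.tendsto_log_atTop.comp hcast).const_div_atTop _)
  obtain ⟨m, h1, h2, h3, h4⟩ := ((hinv.eventually_lt_const hb).and
    ((hlim.eventually_const_lt (by linarith)).and
      ((eventually_ge_atTop (2 * k)).and (eventually_ge_atTop 1)))).exists
  obtain ⟨n, ε, hmn, hε, hεm, hlog, hh⟩ := mem_horseshoeMaps.1 (hf m)
  refine ⟨ε, hbS ⟨hε, hεm.trans h1⟩, ?_⟩
  obtain ⟨p, hp, hsep⟩ := hh.exists_separated hε.le hk (by omega)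
  have hcov := le_coverNum hε p (fun i => hA (hp i)) hsep
  have hn : (0 : ℝ) < n := by
    have : 0 < n := by omega
    exact_mod_cast this
  have hhalf : (n : ℝ) / 2 ≤ coverNum A ε := by
    have : n ≤ coverNum A ε * 2 := by omega
    rw [div_le_iff₀ two_pos]
    exact_mod_cast this
  have hlogcov := Real.log_le_log (half_pos hn) hhalf
  rw [Real.log_div hn.ne' two_ne_zero] at hlogcov
  have hm : (1 : ℝ) ≤ m := by exact_mod_cast h4
  have hmlog : 0 < Real.log ((m : ℝ) + 1) := Real.log_pos (by linarith)
  have hεlog : Real.log ((m : ℝ) + 1) ≤ Real.log (1 / ε) := by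
    refine Real.log_le_log (by linarith) ?_
    rw [lt_div_iff₀ (by linarith)] at hεm
    rw [le_div_iff₀ hε]
    linarith
  rw [le_div_iff₀ (hmlog.trans_le hεlog)]
  have hlog2 : Real.log 2 ≤ Real.log 2 / Real.log ((m : ℝ) + 1) * Real.log (1 / ε) := by
    rw [div_mul_eq_mul_div, le_div_iff₀ hmlog]
    exact mul_le_mul_of_nonneg_left hεlog (Real.log_nonneg one_le_two)
  have := mul_le_mul_of_nonneg_right h2.le (hmlog.trans_le hεlog).le
  linarith

theorem generic_Per_upperBoxDim_one :
    ∃ R : Set ↥CLam, R ∈ residual ↥CLam ∧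
      ∀ f ∈ R, ∀ k : ℕ, 1 ≤ k →
        upperBoxDim (PerSet (⇑f.1) k) = 1 ∧ upperBoxDim (FixSet (⇑f.1) k) = 1 := by
  refine ⟨⋂ m, (↑) ⁻¹' horseshoeMaps m, countable_iInter_mem.2 fun m => residual_of_dense_open
    ((isOpen_horseshoeMaps m).preimage continuous_subtype_val) (dense_horseshoeMaps m),
    fun f hf k hk => ?_⟩
  have hf' : ∀ m, f.1 ∈ horseshoeMaps m := fun m => mem_iInter.1 hf m
  exact ⟨upperBoxDim_eq_one fun a ha => frequently_le_log_coverNum_div hf' hk subset_rfl ha,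
    upperBoxDim_eq_one fun a ha => frequently_le_log_coverNum_div hf' hk (fun x hx => hx.1) ha⟩
end
end
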